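/- Let M = (S, A, s0, P) be a reward-free MDP with finite state space S satisfying the RESET assumption, let L ≥ 1 and ε ∈ (0,1]. Suppose the layer sequence (K*_j) for radius L is ε-identifiable, i.e., for every j ≥ 2 and every g ∈ S \ K*_j one has V*_{K*_{j−1}, g}(s0) > L(1+ε). Then S→_L = S→_{L(1+ε)}. -/

import Mathlib

open scoped ENNReal Classical

/-- A reward-free MDP with countable state space `S`, action space `A` containing a
distinguished `RESET` action, initial state `s0`, and transition kernel `P`,
satisfying the RESET assumption. -/
structure RFMDP (S : Type) (A : Type) where
  s0 : S
  reset : A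
  P : S → A → PMF S
  reset_eq : ∀ s : S, P s reset s0 = 1

namespace RFMDP

variable {S A : Type}

/-- `survive M π g n s` is the probability that the Markov chain started at `s` and
following policy `π` has not yet hit the goal `g` within the first `n+1` visited states,
i.e. `P(T > n)` where `T = inf {i ≥ 0 : s_{i+1} = g}` and `s_1 = s`. -/
noncomputable def survive (M : RFMDP S A) (π : S → A) (g : S) : ℕ → S → ℝ≥0∞
  | 0, s => if s = g then 0 else 1
  | n + 1, s => if s = g then 0 else ∑' s' : S, M.P s (π s) s' * survive M π g n s'

/-- The value `V^π_g(s)`: the expected hitting time of the goal `g` starting from `s`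
and following policy `π` (`+∞` if `g` is almost surely unreachable), computed as
`E[T] = Σ_{n ≥ 0} P(T > n)`. -/
noncomputable def V (M : RFMDP S A) (π : S → A) (g s : S) : ℝ≥0∞ :=
  ∑' n : ℕ, M.survive π g n s

/-- The set `Π(X)` of policies restricted on `X`: those playing `RESET` outside `X`. -/
def restrictedPolicies (M : RFMDP S A) (X : Set S) : Set (S → A) :=
  {π | ∀ s ∉ X, π s = M.reset}

/-- `V*_{X,g}(s)`: the optimal hitting time of `g` from `s` over policies restricted on `X`. -/
noncomputable def Vstar (M : RFMDP S A) (X : Set S) (g s : S) : ℝ≥0∞ :=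
  ⨅ π ∈ M.restrictedPolicies X, M.V π g s

/-- The state-expansion operator `T_L`. -/
def TL (M : RFMDP S A) (L : ℝ) (X : Set S) : Set S :=
  {s | M.Vstar X s M.s0 ≤ ENNReal.ofReal L}

/-- `S_L^≺`: the least subset of `S` containing `s0` and closed under adding any state `s`
reachable in at most `L` expected steps from `s0` by a policy restricted on
`{s' ∈ S_L^≺ : s' ≺ s}`. -/
def SLprec (M : RFMDP S A) (L : ℝ) (prec : S → S → Prop) : Set S :=
  sInf {X : Set S | M.s0 ∈ X ∧
    ∀ s : S, (∃ π ∈ M.restrictedPolicies {s' ∈ X | prec s' s},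
      M.V π s M.s0 ≤ ENNReal.ofReal L) → s ∈ X}

/-- The set `S→_L` of incrementally `L`-controllable states: the union of `S_L^≺` over
all (strict) partial orders `≺` on `S`. -/
def SLarrow (M : RFMDP S A) (L : ℝ) : Set S :=
  ⋃ (prec : S → S → Prop) (_ : IsStrictOrder S prec), M.SLprec L prec

/-- The layer sequence: `layer 0 = {s0} = K*_1` and `layer (n+1) = T_L (layer n) = K*_{n+2}`. -/
noncomputable def layer (M : RFMDP S A) (L : ℝ) : ℕ → Set S
  | 0 => {M.s0}
  | n + 1 => M.TL L (M.layer L n)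

end RFMDP

namespace RFMDP

variable {S A : Type} (M : RFMDP S A)

lemma restrictedPolicies_mono {X Y : Set S} (h : X ⊆ Y) {π : S → A}
    (hπ : π ∈ M.restrictedPolicies X) : π ∈ M.restrictedPolicies Y :=
  fun s hs => hπ s fun hX => hs (h hX)

lemma Vstar_anti {X Y : Set S} (h : X ⊆ Y) (g s : S) : M.Vstar Y g s ≤ M.Vstar X g s :=
  biInf_mono fun _ hπ => M.restrictedPolicies_mono h hπ

lemma TL_mono (L : ℝ) : Monotone (M.TL L) :=
  fun _ _ h s hs => (M.Vstar_anti h s M.s0).trans hs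

lemma survive_self (π : S → A) (g : S) (n : ℕ) : M.survive π g n g = 0 := by
  cases n <;> simp [survive]

lemma V_self (π : S → A) (g : S) : M.V π g g = 0 := by
  simp [V, survive_self]

lemma const_reset_mem_restrictedPolicies (X : Set S) :
    (fun _ => M.reset) ∈ M.restrictedPolicies X :=
  fun _ _ => rfl

lemma Vstar_le_V {X : Set S} {π : S → A} (hπ : π ∈ M.restrictedPolicies X) (g s : S) :
    M.Vstar X g s ≤ M.V π g s :=
  iInf₂_le π hπ

lemma exists_V_eq_Vstar [Finite S] [Finite A] (X : Set S) (g s : S) :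
    ∃ π ∈ M.restrictedPolicies X, M.V π g s = M.Vstar X g s := by
  obtain ⟨π, hπ, hmin⟩ := Set.exists_min_image (M.restrictedPolicies X) (fun π => M.V π g s)
    (Set.toFinite _) ⟨_, M.const_reset_mem_restrictedPolicies X⟩
  exact ⟨π, hπ, le_antisymm (le_iInf₂ hmin) (M.Vstar_le_V hπ g s)⟩

lemma s0_mem_TL (L : ℝ) (X : Set S) : M.s0 ∈ M.TL L X :=
  (M.Vstar_le_V (M.const_reset_mem_restrictedPolicies X) M.s0 M.s0).trans (by simp [V_self])

lemma s0_mem_layer (L : ℝ) : ∀ n, M.s0 ∈ M.layer L n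
  | 0 => rfl
  | _ + 1 => M.s0_mem_TL L _

lemma layer_mono (L : ℝ) : Monotone (M.layer L) := by
  refine monotone_nat_of_le_succ fun n => ?_
  induction n with
  | zero => exact Set.singleton_subset_iff.2 (M.s0_mem_layer L 1)
  | succ n ih => exact M.TL_mono L ih

lemma s0_mem_SLprec (L : ℝ) (prec : S → S → Prop) : M.s0 ∈ M.SLprec L prec :=
  fun _ hX => hX.1

lemma mem_SLprec_of_V_le {L : ℝ} {prec : S → S → Prop} {s : S} {π : S → A}
    (hπ : π ∈ M.restrictedPolicies {s' ∈ M.SLprec L prec | prec s' s})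
    (hV : M.V π s M.s0 ≤ ENNReal.ofReal L) : s ∈ M.SLprec L prec :=
  fun X hX =>
    have h : {s' ∈ M.SLprec L prec | prec s' s} ⊆ {s' ∈ X | prec s' s} :=
      fun _ h => ⟨h.1 X hX, h.2⟩
    hX.2 s ⟨π, M.restrictedPolicies_mono h hπ, hV⟩

lemma SLprec_mono {L L' : ℝ} (h : L ≤ L') (prec : S → S → Prop) :
    M.SLprec L prec ⊆ M.SLprec L' prec :=
  fun _ hs X hX => hs X ⟨hX.1, fun t ⟨π, hπ, hV⟩ =>
    hX.2 t ⟨π, hπ, hV.trans (ENNReal.ofReal_le_ofReal h)⟩⟩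

lemma SLarrow_mono {L L' : ℝ} (h : L ≤ L') : M.SLarrow L ⊆ M.SLarrow L' :=
  Set.iUnion₂_mono fun prec _ => M.SLprec_mono h prec

/-- `s` enters the layer sequence strictly before `t`. -/
def layerLT (L : ℝ) (s t : S) : Prop :=
  ∃ n, s ∈ M.layer L n ∧ t ∉ M.layer L n

lemma isStrictOrder_layerLT (L : ℝ) : IsStrictOrder S (M.layerLT L) where
  irrefl := fun _ ⟨_, h, h'⟩ => h' h
  trans := fun _ _ _ ⟨n, hs, ht⟩ ⟨m, ht', hu⟩ =>
    ⟨m, (le_total n m).elim (fun h => M.layer_mono L h hs)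
      (fun h => absurd (M.layer_mono L h ht') ht), hu⟩

lemma layer_subset_SLprec_layerLT [Finite S] [Finite A] (L : ℝ) (n : ℕ) :
    M.layer L n ⊆ M.SLprec L (M.layerLT L) := by
  induction n with
  | zero => exact Set.singleton_subset_iff.2 (M.s0_mem_SLprec L _)
  | succ n ih =>
    intro s hs
    by_cases hn : s ∈ M.layer L n
    · exact ih hn
    obtain ⟨π, hπ, hV⟩ := M.exists_V_eq_Vstar (M.layer L n) s M.s0
    have h : M.layer L n ⊆ {t ∈ M.SLprec L (M.layerLT L) | M.layerLT L t s} :=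
      fun t ht => ⟨ih ht, n, ht, hn⟩
    exact M.mem_SLprec_of_V_le (M.restrictedPolicies_mono h hπ) (hV.trans_le hs)

lemma layer_subset_SLarrow [Finite S] [Finite A] (L : ℝ) (n : ℕ) :
    M.layer L n ⊆ M.SLarrow L :=
  fun _ hs => Set.mem_iUnion₂.2
    ⟨M.layerLT L, M.isStrictOrder_layerLT L, M.layer_subset_SLprec_layerLT L n hs⟩

lemma SLarrow_subset_of_TL_subset {L : ℝ} {X : Set S} (h0 : M.s0 ∈ X) (hX : M.TL L X ⊆ X) :
    M.SLarrow L ⊆ X :=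
  Set.iUnion₂_subset fun _ _ _ hs => hs X ⟨h0, fun t ⟨_, hπ, hV⟩ => hX
    ((M.Vstar_le_V (M.restrictedPolicies_mono (fun _ h => h.1) hπ) t M.s0).trans hV)⟩

end RFMDP

/-- if the layer sequence is `ε`-identifiable (every `g ∉ K*_j`, `j ≥ 2`,
has `V*_{K*_{j-1},g}(s0) > L(1+ε)`; recall `layer n = K*_{n+1}`), then
`S→_L = S→_{L(1+ε)}`. -/
theorem identifiable_implies_SLarrow_eq
    {S A : Type} [Finite S] [Finite A] (M : RFMDP S A) (L ε : ℝ) (hL : 1 ≤ L)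
    (hε0 : 0 < ε) (hε1 : ε ≤ 1)
    (hid : ∀ j : ℕ, ∀ g : S, g ∉ M.layer L (j + 1) →
      ENNReal.ofReal (L * (1 + ε)) < M.Vstar (M.layer L j) g M.s0) :
    M.SLarrow L = M.SLarrow (L * (1 + ε)) := by
  obtain ⟨N, hN⟩ := WellFoundedGT.monotone_chain_condition ⟨M.layer L, M.layer_mono L⟩
  have hN' : M.layer L N = M.layer L (N + 1) := hN (N + 1) N.le_succ
  refine (M.SLarrow_mono (by nlinarith)).antisymm
    ((M.SLarrow_subset_of_TL_subset (M.s0_mem_layer L N) fun g hg => ?_).trans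
      (M.layer_subset_SLarrow L N))
  by_contra hgN
  exact (hid N g (hN' ▸ hgN)).not_ge hg
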